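/- Let n, p ≥ 1, F, F̃ ∈ ℝ^{n×n} and G, G̃ ∈ ℝ^{p×n}. Set λ := ‖F‖₂ and suppose ‖F̃ − F‖₂ ≤ η and ‖G̃ − G‖₂ ≤ μ for some η, μ ≥ 0 with λ + η < 1. Let M ∈ ℝ be any constant with (t−1)(λ+η)^{t−2} ≤ M for every integer t ≥ 2. Then for every integer t ≥ 1: ‖G̃ F̃^{t−1} − G F^{t−1}‖₂ ≤ (‖G‖₂ + μ) M η + μ. -/

import Mathlib

open Matrix

/-- The spectral (operator 2-)norm of a real matrix. -/
noncomputable def sn {r c : ℕ} (A : Matrix (Fin r) (Fin c) ℝ) : ℝ :=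
  ‖LinearMap.toContinuousLinearMap (Matrix.toEuclideanLin A)‖

open scoped Matrix.Norms.L2Operator in
lemma sn_eq_l2_opNorm {r c : ℕ} (A : Matrix (Fin r) (Fin c) ℝ) : sn A = ‖A‖ :=
  rfl

lemma norm_pow_sub_pow_le_of_norm_le {R : Type*} [NormedRing R] [NormOneClass R] {a b : R}
    {r : ℝ} (ha : ‖a‖ ≤ r) (hb : ‖b‖ ≤ r) (k : ℕ) :
    ‖a ^ (k + 1) - b ^ (k + 1)‖ ≤ (k + 1) * r ^ k * ‖a - b‖ := by
  have hr : 0 ≤ r := (norm_nonneg a).trans ha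
  induction k with
  | zero => simp
  | succ k ih =>
    have hsplit : a ^ (k + 1 + 1) - b ^ (k + 1 + 1)
        = a * (a ^ (k + 1) - b ^ (k + 1)) + (a - b) * b ^ (k + 1) := by
      rw [pow_succ' a, pow_succ' b (k + 1)]
      noncomm_ring
    have hbk : ‖b ^ (k + 1)‖ ≤ r ^ (k + 1) :=
      (norm_pow_le b (k + 1)).trans (pow_le_pow_left₀ (norm_nonneg b) hb _)
    calc ‖a ^ (k + 1 + 1) - b ^ (k + 1 + 1)‖
        ≤ ‖a‖ * ‖a ^ (k + 1) - b ^ (k + 1)‖ + ‖a - b‖ * ‖b ^ (k + 1)‖ := by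
          rw [hsplit]
          exact (norm_add_le _ _).trans (add_le_add (norm_mul_le _ _) (norm_mul_le _ _))
      _ ≤ r * ((k + 1) * r ^ k * ‖a - b‖) + ‖a - b‖ * r ^ (k + 1) := by gcongr
      _ = ((k + 1 : ℕ) + 1) * r ^ (k + 1) * ‖a - b‖ := by push_cast; ring

/-- uniform output-trajectory perturbation bound: if `‖F̃ − F‖₂ ≤ η`,
`‖G̃ − G‖₂ ≤ μ`, `λ + η < 1` with `λ = ‖F‖₂`, and `M` dominates `(t−1)(λ+η)^{t−2}` for all
`t ≥ 2`, then for every `t ≥ 1`,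
`‖G̃ F̃^{t−1} − G F^{t−1}‖₂ ≤ (‖G‖₂ + μ) M η + μ`. -/
theorem stmt11 {n p : ℕ} (hn : 0 < n) (hp : 0 < p)
    (F Ftil : Matrix (Fin n) (Fin n) ℝ)
    (G Gtil : Matrix (Fin p) (Fin n) ℝ)
    (η μ : ℝ) (hη : 0 ≤ η) (hμ : 0 ≤ μ)
    (hFF : sn (Ftil - F) ≤ η) (hGG : sn (Gtil - G) ≤ μ)
    (hlt : sn F + η < 1)
    (M : ℝ) (hM : ∀ t : ℕ, 2 ≤ t → ((t : ℝ) - 1) * (sn F + η) ^ (t - 2) ≤ M) :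
    ∀ t : ℕ, 1 ≤ t →
      sn (Gtil * Ftil ^ (t - 1) - G * F ^ (t - 1)) ≤ (sn G + μ) * M * η + μ := by
  open scoped Matrix.Norms.L2Operator in
  have : Nonempty (Fin n) := ⟨⟨0, hn⟩⟩
  simp only [sn_eq_l2_opNorm] at *
  have hM0 : 0 ≤ M := by
    have h := hM 2 le_rfl
    norm_num at h
    linarith
  have hFt : ‖Ftil‖ ≤ ‖F‖ + η := by
    calc ‖Ftil‖ = ‖F + (Ftil - F)‖ := by rw [add_sub_cancel]
      _ ≤ ‖F‖ + η := (norm_add_le _ _).trans (by gcongr)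
  have hGt : ‖Gtil‖ ≤ ‖G‖ + μ := by
    calc ‖Gtil‖ = ‖G + (Gtil - G)‖ := by rw [add_sub_cancel]
      _ ≤ ‖G‖ + μ := (norm_add_le _ _).trans (by gcongr)
  intro t ht
  obtain ⟨k, rfl⟩ : ∃ k, t = k + 1 := ⟨t - 1, by omega⟩
  rw [Nat.add_sub_cancel]
  have hpow : ‖F ^ k‖ ≤ 1 :=
    (norm_pow_le F k).trans (pow_le_one₀ (norm_nonneg F) (by linarith))
  have hdiff : ‖Ftil ^ k - F ^ k‖ ≤ M * η := by
    cases k with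
    | zero => simpa using mul_nonneg hM0 hη
    | succ j =>
      have hMj : ((j : ℝ) + 1) * (‖F‖ + η) ^ j ≤ M := by
        simpa using hM (j + 1 + 1) (by omega)
      exact (norm_pow_sub_pow_le_of_norm_le hFt (by linarith) j).trans
        (mul_le_mul hMj hFF (norm_nonneg _) hM0)
  have hsplit : Gtil * Ftil ^ k - G * F ^ k
      = Gtil * (Ftil ^ k - F ^ k) + (Gtil - G) * F ^ k := by
    rw [Matrix.mul_sub, Matrix.sub_mul]
    abel
  calc ‖Gtil * Ftil ^ k - G * F ^ k‖
      ≤ ‖Gtil‖ * ‖Ftil ^ k - F ^ k‖ + ‖Gtil - G‖ * ‖F ^ k‖ := by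
        rw [hsplit]
        exact (norm_add_le _ _).trans
          (add_le_add (Matrix.l2_opNorm_mul _ _) (Matrix.l2_opNorm_mul _ _))
    _ ≤ (‖G‖ + μ) * (M * η) + μ * 1 := by gcongr
    _ = (‖G‖ + μ) * M * η + μ := by ring
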